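/- Let A = F_q[T], P irreducible of degree d, m and d both odd. The number of ordinary characteristic polynomials X^2 - cX + μP^m (i.e., with μ ∈ F_q^*, c ∈ A coprime to P, deg c ≤ md/2, and c^2 - 4μP^m imaginary), equivalently the number of ordinary isogeny classes of rank-2 Drinfeld A-modules over L = F_{q^{md}}, equals (q-1)·(q^{⌊md/2⌋+1} - q^{⌊(m-2)d/2⌋+1}). -/

import Mathlib

open Polynomial

section LaurentAtInfinity

variable {F : Type*} [Field F]

theorem LaurentSeries.aeval_X_inv_coeff (c : F[X]) (k : ℤ) :
    (aeval ((PowerSeries.X : PowerSeries F) : LaurentSeries F)⁻¹ c).coeff k =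
      if k ≤ 0 then c.coeff (-k).toNat else 0 := by
  induction c using Polynomial.induction_on' with
  | add p q hp hq =>
    rw [map_add, HahnSeries.coeff_add, hp, hq]
    split_ifs <;> simp
  | monomial n a =>
    rw [aeval_monomial, HahnSeries.ofPowerSeries_X, HahnSeries.inv_single, HahnSeries.single_pow,
      HahnSeries.algebraMap_apply', PowerSeries.algebraMap_apply, Algebra.algebraMap_self_apply,
      HahnSeries.ofPowerSeries_C, HahnSeries.C_mul_eq_smul, HahnSeries.coeff_smul,
      HahnSeries.coeff_single, coeff_monomial]
    by_cases hk : k = -(n : ℤ)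
    · subst hk
      simp
    · have hk' : k ≤ 0 → n ≠ (-k).toNat := by omega
      simp [hk]
      exact fun h h' => absurd h' (hk' h)

theorem LaurentSeries.aeval_X_inv_ne_zero {c : F[X]} (hc : c ≠ 0) :
    aeval ((PowerSeries.X : PowerSeries F) : LaurentSeries F)⁻¹ c ≠ 0 := by
  intro h
  have := aeval_X_inv_coeff c (-(c.natDegree : ℤ))
  rw [h] at this
  simp [eq_comm (a := (0 : F)), hc] at this

theorem LaurentSeries.order_aeval_X_inv {c : F[X]} (hc : c ≠ 0) :
    (aeval ((PowerSeries.X : PowerSeries F) : LaurentSeries F)⁻¹ c).order =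
      -(c.natDegree : ℤ) := by
  apply le_antisymm
  · apply HahnSeries.order_le_of_coeff_ne_zero
    rw [aeval_X_inv_coeff]
    simp [hc]
  · by_contra! h
    have h0 := mt HahnSeries.coeff_order_eq_zero.mp (aeval_X_inv_ne_zero hc)
    rw [aeval_X_inv_coeff, if_pos (by omega)] at h0
    exact h0 (coeff_eq_zero_of_natDegree_lt (by omega))

theorem LaurentSeries.sub_add_ne_zero_of_order_lt_left {a b c : LaurentSeries F} (ha : a ≠ 0)
    (hb : a.order < b.order) (hc : a.order < c.order) : a - b + c ≠ 0 := by
  intro h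
  have := congrArg (fun x => x.coeff a.order) h
  simp [HahnSeries.coeff_eq_zero_of_lt_order hb, HahnSeries.coeff_eq_zero_of_lt_order hc,
    ha] at this

theorem LaurentSeries.sub_add_ne_zero_of_order_lt_right {a b c : LaurentSeries F} (hc : c ≠ 0)
    (ha : c.order < a.order) (hb : c.order < b.order) : a - b + c ≠ 0 := by
  intro h
  have := congrArg (fun x => x.coeff c.order) h
  simp [HahnSeries.coeff_eq_zero_of_lt_order hb, HahnSeries.coeff_eq_zero_of_lt_order ha,
    hc] at this

/-- A monic quadratic over `F[T]` whose constant term has odd degree at least twice the degree of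
the linear coefficient has no root in `F((1/T))`. -/
theorem LaurentSeries.quadratic_ne_zero_of_odd {c r : F[X]} (hc : c ≠ 0)
    (hr : Odd r.natDegree) (hdeg : 2 * c.natDegree ≤ r.natDegree) (θ : LaurentSeries F) :
    θ ^ 2 - aeval ((PowerSeries.X : PowerSeries F) : LaurentSeries F)⁻¹ c * θ
      + aeval ((PowerSeries.X : PowerSeries F) : LaurentSeries F)⁻¹ r ≠ 0 := by
  have hr0 : r ≠ 0 := by
    rintro rfl
    simp at hr
  have hR := aeval_X_inv_ne_zero hr0
  have hRo := order_aeval_X_inv hr0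
  rcases eq_or_ne θ 0 with rfl | hθ
  · simpa using hR
  have ho1 : (θ ^ 2).order = 2 * θ.order := by simp
  have ho2 := HahnSeries.order_mul (aeval_X_inv_ne_zero hc) hθ
  rw [order_aeval_X_inv hc] at ho2
  obtain ⟨k, hk⟩ := hr
  rcases lt_or_ge (2 * θ.order) (-(r.natDegree : ℤ)) with h | h
  · apply sub_add_ne_zero_of_order_lt_left (pow_ne_zero 2 hθ) <;> omega
  · apply sub_add_ne_zero_of_order_lt_right hR <;> omega

end LaurentAtInfinity

section Counting

variable {F : Type*} [Field F]

theorem Polynomial.finite_degreeLT [Finite F] (n : ℕ) : (degreeLT F n : Set F[X]).Finite :=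
  @Set.toFinite _ _ (Finite.of_equiv _ (degreeLTEquiv F n).toEquiv.symm)

theorem Polynomial.ncard_degreeLT [Fintype F] (n : ℕ) :
    (degreeLT F n : Set F[X]).ncard = Fintype.card F ^ n := by
  rw [← Nat.card_coe_set_eq]
  exact (Nat.card_congr (degreeLTEquiv F n).toEquiv).trans (by simp)

theorem Polynomial.ncard_degreeLT_not_dvd [Fintype F] {P : F[X]} (hP : P ≠ 0) {n : ℕ}
    (hn : P.natDegree ≤ n) :
    {c : F[X] | c ∈ degreeLT F n ∧ ¬ P ∣ c}.ncard =
      Fintype.card F ^ n - Fintype.card F ^ (n - P.natDegree) := by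
  have hmul : ∀ e : F[X], P * e ∈ degreeLT F n ↔ e ∈ degreeLT F (n - P.natDegree) := by
    intro e
    rcases eq_or_ne e 0 with rfl | he
    · simp
    rw [mem_degreeLT, mem_degreeLT, ← natDegree_lt_iff_degree_lt (mul_ne_zero hP he),
      ← natDegree_lt_iff_degree_lt he, natDegree_mul hP he]
    omega
  have hsub : (P * ·) '' (degreeLT F (n - P.natDegree) : Set F[X]) ⊆ degreeLT F n := by
    rintro _ ⟨e, he, rfl⟩
    exact (hmul e).2 he
  have hset : {c : F[X] | c ∈ degreeLT F n ∧ ¬ P ∣ c} =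
      (degreeLT F n : Set F[X]) \ (P * ·) '' (degreeLT F (n - P.natDegree) : Set F[X]) := by
    ext c
    refine and_congr_right fun hc => not_congr ⟨?_, ?_⟩
    · rintro ⟨e, rfl⟩
      exact ⟨e, (hmul e).1 hc, rfl⟩
    · rintro ⟨e, -, rfl⟩
      exact dvd_mul_right P e
  rw [hset, Set.ncard_sdiff hsub ((finite_degreeLT n).subset hsub),
    Set.ncard_image_of_injective _ (mul_right_injective₀ hP), ncard_degreeLT, ncard_degreeLT]

theorem Polynomial.quadratic_injective {R : F[X]} (hR : R ≠ 0) :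
    Function.Injective fun x : Fˣ × F[X] =>
      (X ^ 2 - C x.2 * X + C ((x.1 : F) • R) : F[X][X]) := by
  rintro ⟨μ, c⟩ ⟨ν, e⟩ h
  have h0 := congrArg (fun f => coeff f 0) h
  have h1 := congrArg (fun f => coeff f 1) h
  simp [coeff_X_pow, coeff_C] at h0 h1
  have := smul_left_injective F hR h0
  simp [Units.ext this, h1]

end Counting

/-- Let `A = F_q[T]`, `P` irreducible of degree `d`, with `m ≥ 2` and `m`, `d` both odd.
The number of ordinary characteristic polynomials `X² - cX + μP^m`
(with `μ ∈ F_qˣ`, `c ∈ A` not divisible by `P`, `deg c ≤ md/2`, and discriminant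
imaginary — i.e. `x² - cx + μP^m` has no root in `K_∞ = F_q((1/T))`, which is automatic
as `md` is odd), equivalently the number of ordinary isogeny classes of rank-2 Drinfeld
`A`-modules over `F_{q^{md}}`, equals `(q-1)·(q^{⌊md/2⌋+1} - q^{⌊(m-2)d/2⌋+1})`. -/
theorem card_ordinary_isogeny_classes_odd (Fq : Type*) [Field Fq] [Fintype Fq]
    (q : ℕ) (hq : Fintype.card Fq = q)
    (P : Polynomial Fq) (hP : Irreducible P) (hPm : P.Monic)
    (d m : ℕ) (hd : P.natDegree = d) (hmodd : Odd m) (hdodd : Odd d) (hm2 : 2 ≤ m) :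
    Nat.card {f : Polynomial (Polynomial Fq) |
      ∃ μ : Fqˣ, ∃ c : Polynomial Fq, ¬ P ∣ c ∧ 2 * c.natDegree ≤ m * d ∧
        (∀ θ : LaurentSeries Fq,
          θ ^ 2 - Polynomial.aeval ((PowerSeries.X : PowerSeries Fq) : LaurentSeries Fq)⁻¹ c * θ
            + algebraMap Fq (LaurentSeries Fq) (μ : Fq)
              * Polynomial.aeval ((PowerSeries.X : PowerSeries Fq) : LaurentSeries Fq)⁻¹ P ^ m
            ≠ 0) ∧
        f = X ^ 2 - C c * X + C ((μ : Fq) • P ^ m)} =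
      (q - 1) * (q ^ ((m * d) / 2 + 1) - q ^ (((m - 2) * d) / 2 + 1)) := by
  classical
  subst hq hd
  have hP0 := hP.ne_zero
  have hdeg : ∀ μ : Fqˣ, ((μ : Fq) • P ^ m).natDegree = m * P.natDegree := fun μ => by
    rw [natDegree_smul_of_smul_regular _ (IsSMulRegular.of_ne_zero μ.ne_zero), natDegree_pow]
  have hbound : 3 * P.natDegree ≤ m * P.natDegree :=
    Nat.mul_le_mul_right _ (by obtain ⟨k, rfl⟩ := hmodd; omega)
  have hexp : (m - 2) * P.natDegree / 2 + 1 = m * P.natDegree / 2 + 1 - P.natDegree := by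
    rw [Nat.sub_mul]
    omega
  rw [hexp, ← ncard_degreeLT_not_dvd hP0 (by omega), ← Fintype.card_units,
    ← Nat.card_eq_fintype_card (α := Fqˣ), ← Set.ncard_univ Fqˣ, ← Set.ncard_prod, ← Set.ncard_image_of_injective _
      (quadratic_injective (pow_ne_zero m hP0)), Nat.card_coe_set_eq]
  congr 1
  have hmem : ∀ c : Fq[X], c ≠ 0 → (c ∈ degreeLT Fq (m * P.natDegree / 2 + 1) ↔
      2 * c.natDegree ≤ m * P.natDegree) := fun c hc => by
    rw [mem_degreeLT, ← natDegree_lt_iff_degree_lt hc]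
    omega
  have hne : ∀ c : Fq[X], ¬ P ∣ c → c ≠ 0 := by
    rintro _ h rfl
    exact h (dvd_zero P)
  ext f
  constructor
  · rintro ⟨μ, c, hc, hd, -, rfl⟩
    exact ⟨(μ, c), ⟨trivial, (hmem c (hne c hc)).2 hd, hc⟩, rfl⟩
  · rintro ⟨⟨μ, c⟩, ⟨-, hd, hc⟩, rfl⟩
    have hd' := (hmem c (hne c hc)).1 hd
    refine ⟨μ, c, hc, hd', fun θ => ?_, rfl⟩
    have := LaurentSeries.quadratic_ne_zero_of_odd (hne c hc) (r := (μ : Fq) • P ^ m)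
      (by rw [hdeg]; exact hmodd.mul hdodd) (by rwa [hdeg]) θ
    rwa [smul_eq_C_mul, map_mul, aeval_C, map_pow] at this
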